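/- arXiv:1104.0999 — 3 statements merged into one kernel-verified Lean document; each statement's English description precedes it below -/
import Mathlib

section
/- The subgroup of the group of bijections of ℝ² generated by the two maps g̃₀ : (X,Y) ↦ (Y,X) and g̃₁ : (X,Y) ↦ (Y−X,−X) is isomorphic (as a group) to the dihedral group of degree three (order six). -/
/-- The tropical reflection `g̃₀ : (X,Y) ↦ (Y,X)` as a bijection of `ℝ²`. -/
def tropG0 : Equiv.Perm (ℝ × ℝ) :=
  ⟨fun p => (p.2, p.1), fun p => (p.2, p.1), fun p => by simp, fun p => by simp⟩

/-- The tropical translation `g̃₁ : (X,Y) ↦ (Y−X,−X)` as a bijection of `ℝ²`. -/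
def tropG1 : Equiv.Perm (ℝ × ℝ) :=
  ⟨fun p => (p.2 - p.1, -p.1), fun p => (-p.2, p.1 - p.2),
    fun p => by simp, fun p => by simp⟩

/-- The underlying map of the isomorphism. -/
def tropFun : DihedralGroup 3 → Equiv.Perm (ℝ × ℝ)
  | .r i => tropG1 ^ i.val
  | .sr i => tropG0 * tropG1 ^ i.val

lemma tropG0_apply (p : ℝ × ℝ) : tropG0 p = (p.2, p.1) := rfl

lemma tropG1_apply (p : ℝ × ℝ) : tropG1 p = (p.2 - p.1, -p.1) := rfl

lemma tropG1_cube : tropG1 ^ 3 = 1 := by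
  ext p <;> simp [pow_succ, tropG1_apply] <;> ring

lemma tropG0_sq : tropG0 * tropG0 = 1 := by
  ext p <;> simp [tropG0_apply]

lemma tropG1_mul_tropG0 : tropG1 * tropG0 = tropG0 * tropG1 ^ 2 := by
  ext p <;> simp [pow_succ, tropG0_apply, tropG1_apply] <;> ring

lemma tropG1_pow_mul_tropG0 (i : ℕ) : tropG1 ^ i * tropG0 = tropG0 * tropG1 ^ (2 * i) := by
  induction i with
  | zero => simp
  | succ k ih =>
    rw [pow_succ, mul_assoc, tropG1_mul_tropG0, ← mul_assoc, ih, mul_assoc, ← pow_add]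
    ring_nf

lemma tropG1_pow_congr {a b : ℕ} (h : a % 3 = b % 3) : tropG1 ^ a = tropG1 ^ b := by
  rw [pow_eq_pow_mod a tropG1_cube, pow_eq_pow_mod b tropG1_cube, h]

/-- The homomorphism from the dihedral group. -/
def tropHom : DihedralGroup 3 →* Equiv.Perm (ℝ × ℝ) :=
  MonoidHom.mk' tropFun (by
    rintro (i | i) (j | j)
    · change tropG1 ^ (i + j).val = tropG1 ^ i.val * tropG1 ^ j.val
      rw [← pow_add]
      apply tropG1_pow_congr
      revert i j; decide
    · change tropG0 * tropG1 ^ (j - i).val = tropG1 ^ i.val * (tropG0 * tropG1 ^ j.val)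
      rw [← mul_assoc, tropG1_pow_mul_tropG0, mul_assoc, ← pow_add]
      congr 1
      apply tropG1_pow_congr
      revert i j; decide
    · change tropG0 * tropG1 ^ (i + j).val = tropG0 * tropG1 ^ i.val * tropG1 ^ j.val
      rw [mul_assoc, ← pow_add]
      congr 1
      apply tropG1_pow_congr
      revert i j; decide
    · change tropG1 ^ (j - i).val = tropG0 * tropG1 ^ i.val * (tropG0 * tropG1 ^ j.val)
      rw [mul_assoc, ← mul_assoc (tropG1 ^ i.val), tropG1_pow_mul_tropG0, mul_assoc,
        ← mul_assoc tropG0, tropG0_sq, one_mul, ← pow_add]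
      apply tropG1_pow_congr
      revert i j; decide)

lemma tropHom_injective : Function.Injective tropHom := by
  rw [injective_iff_map_eq_one]
  rintro (i | i) h
  · change tropG1 ^ i.val = 1 at h
    have h1 := congrArg (fun e : Equiv.Perm (ℝ × ℝ) => e (1, 3)) h
    have hi : i = 0 ∨ i = 1 ∨ i = 2 := by clear h h1; revert i; decide
    rcases hi with rfl | rfl | rfl
    · rfl
    · change (tropG1 ^ 1) (1, 3) = (1, 3) at h1
      norm_num [tropG1_apply] at h1
    · change (tropG1 ^ 2) (1, 3) = (1, 3) at h1
      norm_num [pow_succ, tropG1_apply] at h1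
  · change tropG0 * tropG1 ^ i.val = 1 at h
    have h1 := congrArg (fun e : Equiv.Perm (ℝ × ℝ) => e (1, 3)) h
    have hi : i = 0 ∨ i = 1 ∨ i = 2 := by clear h h1; revert i; decide
    exfalso
    rcases hi with rfl | rfl | rfl
    · change (tropG0 * tropG1 ^ 0) (1, 3) = (1, 3) at h1
      norm_num [tropG0_apply] at h1
    · change (tropG0 * tropG1 ^ 1) (1, 3) = (1, 3) at h1
      norm_num [tropG0_apply, tropG1_apply] at h1
    · change (tropG0 * tropG1 ^ 2) (1, 3) = (1, 3) at h1
      norm_num [pow_succ, tropG0_apply, tropG1_apply] at h1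

lemma tropHom_range :
    tropHom.range = Subgroup.closure ({tropG0, tropG1} : Set (Equiv.Perm (ℝ × ℝ))) := by
  have h0 : tropG0 ∈ Subgroup.closure ({tropG0, tropG1} : Set (Equiv.Perm (ℝ × ℝ))) :=
    Subgroup.subset_closure (by simp)
  have h1 : tropG1 ∈ Subgroup.closure ({tropG0, tropG1} : Set (Equiv.Perm (ℝ × ℝ))) :=
    Subgroup.subset_closure (by simp)
  apply le_antisymm
  · rintro _ ⟨i | i, rfl⟩
    · exact pow_mem h1 _
    · exact mul_mem h0 (pow_mem h1 _)
  · rw [Subgroup.closure_le]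
    rintro x (rfl | rfl)
    · exact ⟨.sr 0, mul_one _⟩
    · exact ⟨.r 1, pow_one _⟩

/-- The subgroup of bijections of `ℝ²` generated by `g̃₀` and `g̃₁` is isomorphic to the
dihedral group of degree three. -/
theorem trop_hessian_group_iso_dihedral :
    Nonempty
      ((Subgroup.closure ({tropG0, tropG1} : Set (Equiv.Perm (ℝ × ℝ)))) ≃*
        DihedralGroup 3) := by
  rw [← tropHom_range]
  exact ⟨(MonoidHom.ofInjective tropHom_injective).symm⟩
end

section
/- For every K ∈ ℝ, the map g̃₁ : (X,Y) ↦ (Y−X,−X) maps the tropical Hesse curve C_K bijectively onto itself; that is, (X,Y) ∈ C_K if and only if (Y−X,−X) ∈ C_K. -/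
/-- The tropical Hesse curve `C_K`: the set of points of `ℝ²` at which the maximum in
`F(X,Y;K) = max(3X, 3Y, 0, K+X+Y)` is attained by at least two of the four terms. -/
def tropHesseCurve (K : ℝ) : Set (ℝ × ℝ) :=
  {p | ∃ i j : Fin 4, i ≠ j ∧
    (![3 * p.1, 3 * p.2, 0, K + p.1 + p.2] i =
      max (max (3 * p.1) (3 * p.2)) (max 0 (K + p.1 + p.2))) ∧
    (![3 * p.1, 3 * p.2, 0, K + p.1 + p.2] j =
      max (max (3 * p.1) (3 * p.2)) (max 0 (K + p.1 + p.2)))}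

/-- For every `K`, the map `g̃₁ : (X,Y) ↦ (Y−X,−X)` maps the tropical Hesse curve `C_K`
bijectively onto itself: `(X,Y) ∈ C_K ↔ (Y−X,−X) ∈ C_K`. -/
theorem tropG1_maps_tropHesseCurve (K : ℝ) (X Y : ℝ) :
    (X, Y) ∈ tropHesseCurve K ↔ (Y - X, -X) ∈ tropHesseCurve K := by
  have hM : max (max (3 * (Y - X)) (3 * (-X))) (max 0 (K + (Y - X) + -X)) =
      max (max (3 * X) (3 * Y)) (max 0 (K + X + Y)) - 3 * X := by
    rw [← max_sub_sub_right, ← max_sub_sub_right, ← max_sub_sub_right]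
    have h1 : 3 * (Y - X) = 3 * Y - 3 * X := by ring
    have h2 : 3 * (-X) = 0 - 3 * X := by ring
    have h3 : K + (Y - X) + -X = K + X + Y - 3 * X := by ring
    have h4 : (0 : ℝ) = 3 * X - 3 * X := by ring
    rw [h1, h2, h3]
    conv_lhs => rw [max_assoc]
    rw [sub_self, max_comm (0 : ℝ) (3 * Y - 3 * X), max_assoc]
    congr 1
    rw [max_left_comm]
  simp only [tropHesseCurve, Set.mem_setOf_eq, hM]
  generalize max (max (3 * X) (3 * Y)) (max 0 (K + X + Y)) = M
  have key : ∀ i : Fin 4, (![3 * (Y - X), 3 * (-X), 0, K + (Y - X) + -X] i = M - 3 * X) ↔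
      (![3 * X, 3 * Y, 0, K + X + Y] ((![1, 2, 0, 3] : Fin 4 → Fin 4) i) = M) := by
    intro i
    fin_cases i <;> simp <;> constructor <;> intro h <;> linarith
  simp only [key]
  constructor
  · rintro ⟨i, j, hij, hi, hj⟩
    have hinv : ∀ k : Fin 4,
        (![1, 2, 0, 3] : Fin 4 → Fin 4) ((![2, 0, 1, 3] : Fin 4 → Fin 4) k) = k := by decide
    refine ⟨(![2, 0, 1, 3] : Fin 4 → Fin 4) i, (![2, 0, 1, 3] : Fin 4 → Fin 4) j, ?_, ?_, ?_⟩
    · intro h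
      apply hij
      rw [← hinv i, ← hinv j, h]
    · rw [hinv]; exact hi
    · rw [hinv]; exact hj
  · rintro ⟨i, j, hij, hi, hj⟩
    refine ⟨_, _, ?_, hi, hj⟩
    revert i j
    have : ∀ i j : Fin 4, i ≠ j →
        (![1, 2, 0, 3] : Fin 4 → Fin 4) i ≠ (![1, 2, 0, 3] : Fin 4 → Fin 4) j := by decide
    intro i j hij _ _
    exact this i j hij
end

section
/- Let K > 0 and let (X,Y) be a point of the finite part C̄_K of the tropical Hesse curve, i.e. (X,Y) ∈ C_K with |X| ≤ K and |Y| ≤ K. Then the tropical addition of (X,Y) with the vertex V₃ = (0,−K) equals (Y−X, −X); explicitly, max(Y, 2X−K) − max(X, 2Y−K) = Y−X and max(X+Y−2K, 0) − max(X, 2Y−K) = −X. -/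
/-- For `K > 0` and `(X,Y)` on the finite part `C̄_K` of the tropical Hesse curve
(`(X,Y) ∈ C_K`, `|X| ≤ K`, `|Y| ≤ K`), the tropical addition of `(X,Y)` with the vertex
`V₃ = (0,−K)` equals `(Y−X, −X)`. -/
theorem trop_addition_with_V3 (K X Y : ℝ) (hK : 0 < K)
    (hC : (X, Y) ∈ tropHesseCurve K) (hX : |X| ≤ K) (hY : |Y| ≤ K) :
    max Y (2 * X - K) - max X (2 * Y - K) = Y - X ∧
      max (X + Y - 2 * K) 0 - max X (2 * Y - K) = -X := by
  obtain ⟨hX1, hX2⟩ := abs_le.mp hX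
  obtain ⟨hY1, hY2⟩ := abs_le.mp hY
  obtain ⟨i, j, hij, hi, hj⟩ := hC
  have a1 : 3 * X ≤ max (max (3 * X) (3 * Y)) (max 0 (K + X + Y)) := by simp
  have a2 : 3 * Y ≤ max (max (3 * X) (3 * Y)) (max 0 (K + X + Y)) := by simp
  have a3 : 0 ≤ max (max (3 * X) (3 * Y)) (max 0 (K + X + Y)) := by simp
  have a4 : K + X + Y ≤ max (max (3 * X) (3 * Y)) (max 0 (K + X + Y)) := by simp
  dsimp only at hi hj
  generalize max (max (3 * X) (3 * Y)) (max 0 (K + X + Y)) = M at *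
  have h : 2 * X - K ≤ Y ∧ 2 * Y - K ≤ X := by
    fin_cases i <;> fin_cases j <;> simp at hij hi hj <;> constructor <;> linarith
  rw [max_eq_left h.1, max_eq_left h.2, max_eq_right (by linarith)]
  constructor <;> ring
end
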